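/- Let X and Y be locally compact Hausdorff spaces and f : X → Y a continuous map. Define φ_f : RC(Y) → RC(X) by φ_f(G) = cl_X(f⁻¹(int_Y(G))). Then: (1) φ_f(G) is regular closed in X for every regular closed G ⊆ Y, and φ_f(∅) = ∅; (2) φ_f(F ∧ G) = φ_f(F) ∧ φ_f(G) for all F, G ∈ RC(Y), where F ∧ G = cl(int(F ∩ G)); (3) for all F, G ∈ RC(Y) with F ⊆ int(G), one has (φ_f(F*))* ⊆ int(φ_f(G)), where * denotes the complement in RC: H* = cl of the set-complement of H; (4) for every compact regular closed H ⊆ X there is a compact regular closed F ⊆ Y with H ⊆ φ_f(F); (5) for every F ∈ RC(Y), φ_f(F) = cl(⋃{φ_f(G) | G compact regular closed in Y, G ⊆ int(F)}); and (6) for all F₁, G₁, F₂, G₂ ∈ RC(Y) with F₁ ⊆ int(G₁) and F₂ ⊆ int(G₂), φ_f(F₁ ∪ F₂) ⊆ int(φ_f(G₁) ∪ φ_f(G₂)). -/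

import Mathlib

open Set

theorem aux_regular {Z : Type*} [TopologicalSpace Z] {U : Set Z} (hU : IsOpen U) :
    closure U = closure (interior (closure U)) := by
  apply subset_antisymm
  · exact closure_mono (interior_maximal subset_closure hU)
  · exact closure_minimal interior_subset isClosed_closure

theorem aux_inter {Z : Type*} [TopologicalSpace Z] {A B : Set Z} (hA : IsOpen A)
    (hB : IsOpen B) : closure (A ∩ B) = closure (interior (closure A ∩ closure B)) := by
  apply subset_antisymm
  · apply closure_mono
    exact interior_maximal (fun x hx => ⟨subset_closure hx.1, subset_closure hx.2⟩) (hA.inter hB)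
  · apply closure_minimal _ isClosed_closure
    intro x hx
    rw [mem_closure_iff]
    intro N hN hxN
    have h1 : x ∈ closure A := (interior_subset hx).1
    obtain ⟨y, ⟨hyN, hyW⟩, hyA⟩ :=
      mem_closure_iff.1 h1 _ (hN.inter isOpen_interior) ⟨hxN, hx⟩
    have h2 : y ∈ closure B := (interior_subset hyW).2
    obtain ⟨z, ⟨hzN, hzA⟩, hzB⟩ := mem_closure_iff.1 h2 _ (hN.inter hA) ⟨hyN, hyA⟩
    exact ⟨z, hzN, hzA, hzB⟩

theorem aux_compact {Z : Type*} [TopologicalSpace Z] [LocallyCompactSpace Z] [T2Space Z]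
    {K U : Set Z} (hK : IsCompact K) (hU : IsOpen U) (h : K ⊆ U) :
    ∃ F : Set Z, F = closure (interior F) ∧ IsCompact F ∧ K ⊆ interior F ∧ F ⊆ U := by
  obtain ⟨L, hL, hKL, hLU⟩ := exists_compact_between hK hU h
  have hs : closure (interior L) ⊆ L := closure_minimal interior_subset hL.isClosed
  refine ⟨closure (interior L), aux_regular isOpen_interior,
    hL.of_isClosed_subset isClosed_closure hs, ?_, hs.trans hLU⟩
  exact hKL.trans (interior_maximal subset_closure isOpen_interior)

/-- For a continuous map f : X → Y between locally compact Hausdorff spaces,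
the map φ_f : RC(Y) → RC(X), G ↦ cl_X(f⁻¹(int_Y G)), satisfies:
(1) it is well defined and φ_f(∅) = ∅ (conditions (DLC1));
(2) it preserves the meet cl(int(F ∩ G)) of regular closed sets (DLC2);
(3) F ⊆ int G implies (φ_f(F*))* ⊆ int(φ_f(G)), where H* = cl(Hᶜ) (DLC3S);
(4) every compact regular closed H ⊆ X satisfies H ⊆ φ_f(F) for some compact
    regular closed F ⊆ Y (DLC4);
(5) φ_f(F) = cl(⋃{φ_f(G) | G compact regular closed, G ⊆ int F}) (DLC5);
(6) F₁ ⊆ int G₁ and F₂ ⊆ int G₂ imply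
    φ_f(F₁ ∪ F₂) ⊆ int(φ_f(G₁) ∪ φ_f(G₂)) (LC3S). -/
theorem stmt_19 {X Y : Type*} [TopologicalSpace X] [TopologicalSpace Y]
    [LocallyCompactSpace X] [T2Space X] [LocallyCompactSpace Y] [T2Space Y]
    (f : X → Y) (hf : Continuous f)
    (φ : Set Y → Set X) (hφ : ∀ G : Set Y, φ G = closure (f ⁻¹' interior G)) :
    -- (1)
    (∀ G : Set Y, G = closure (interior G) → φ G = closure (interior (φ G))) ∧
    φ ∅ = ∅ ∧
    -- (2)
    (∀ F G : Set Y, F = closure (interior F) → G = closure (interior G) →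
      φ (closure (interior (F ∩ G))) = closure (interior (φ F ∩ φ G))) ∧
    -- (3)
    (∀ F G : Set Y, F = closure (interior F) → G = closure (interior G) →
      F ⊆ interior G → closure ((φ (closure Fᶜ))ᶜ) ⊆ interior (φ G)) ∧
    -- (4)
    (∀ H : Set X, H = closure (interior H) → IsCompact H →
      ∃ F : Set Y, F = closure (interior F) ∧ IsCompact F ∧ H ⊆ φ F) ∧
    -- (5)
    (∀ F : Set Y, F = closure (interior F) →
      φ F = closure (⋃ G ∈ {G : Set Y | G = closure (interior G) ∧
        IsCompact G ∧ G ⊆ interior F}, φ G)) ∧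
    -- (6)
    (∀ F₁ G₁ F₂ G₂ : Set Y,
      F₁ = closure (interior F₁) → G₁ = closure (interior G₁) →
      F₂ = closure (interior F₂) → G₂ = closure (interior G₂) →
      F₁ ⊆ interior G₁ → F₂ ⊆ interior G₂ →
      φ (F₁ ∪ F₂) ⊆ interior (φ G₁ ∪ φ G₂)) := by
  have hop : ∀ G : Set Y, IsOpen (f ⁻¹' interior G) := fun G => isOpen_interior.preimage hf
  have hcl : ∀ F : Set Y, F = closure (interior F) → IsClosed F := by
    intro F hF
    rw [hF]
    exact isClosed_closure
  have hin : ∀ G : Set Y, f ⁻¹' interior G ⊆ interior (φ G) := by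
    intro G
    rw [hφ]
    exact interior_maximal subset_closure (hop G)
  refine ⟨?_, ?_, ?_, ?_, ?_, ?_, ?_⟩
  · intro G _
    rw [hφ]
    exact aux_regular (hop G)
  · rw [hφ]
    simp
  · intro F G hF hG
    have h : interior (closure (interior (F ∩ G))) = interior F ∩ interior G := by
      rw [← interior_inter]
      apply subset_antisymm
      · exact interior_mono (closure_minimal interior_subset ((hcl F hF).inter (hcl G hG)))
      · exact interior_maximal subset_closure isOpen_interior
    rw [hφ, hφ, hφ, h, preimage_inter]
    exact aux_inter (hop F) (hop G)
  · intro F G hF hG hFG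
    have h : (φ (closure Fᶜ))ᶜ ⊆ f ⁻¹' F := by
      intro x hx
      by_contra hxF
      apply hx
      rw [hφ]
      exact subset_closure (interior_maximal subset_closure (hcl F hF).isOpen_compl hxF)
    exact (closure_minimal h ((hcl F hF).preimage hf)).trans
      ((preimage_mono hFG).trans (hin G))
  · intro H _ hc
    obtain ⟨F, h1, h2, h3, _⟩ := aux_compact (hc.image hf) isOpen_univ (subset_univ _)
    exact ⟨F, h1, h2, (image_subset_iff.1 h3).trans ((hin F).trans interior_subset)⟩
  · intro F _
    apply subset_antisymm
    · rw [hφ]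
      apply closure_mono
      intro x hx
      obtain ⟨G, h1, h2, h3, h4⟩ := aux_compact (isCompact_singleton (x := f x))
        (isOpen_interior (s := F)) (singleton_subset_iff.2 hx)
      exact mem_biUnion (show G ∈ {G : Set Y | _} from ⟨h1, h2, h4⟩)
        (interior_subset (hin G (show f x ∈ interior G from singleton_subset_iff.1 h3)))
    · refine closure_minimal (iUnion₂_subset fun G hG => ?_) ?_
      · rw [hφ, hφ]
        exact closure_mono (preimage_mono (interior_subset.trans hG.2.2))
      · rw [hφ]
        exact isClosed_closure
  · intro F₁ G₁ F₂ G₂ hF₁ _ hF₂ _ h₁ h₂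
    have h : φ (F₁ ∪ F₂) ⊆ f ⁻¹' (F₁ ∪ F₂) := by
      rw [hφ]
      exact closure_minimal (preimage_mono interior_subset)
        (((hcl _ hF₁).union (hcl _ hF₂)).preimage hf)
    intro x hx
    rcases h hx with hx | hx
    · exact interior_mono subset_union_left (hin G₁ (h₁ hx))
    · exact interior_mono subset_union_right (hin G₂ (h₂ hx))
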